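/- Let M and N be normal subgroups of a group G and let n ≥ 0 be an integer. Then [[M,N],_n G] is contained in the product (join) over ℓ = 0,…,n of the subgroups [[M,_{n-ℓ}G], [N,_ℓ G]]. -/

import Mathlib

/-- The iterated commutator `[A,_n B]`, with `[A,_0 B] = A` and `[A,_n B] = [[A,_{n-1}B],B]`. -/
def iterComm {G : Type*} [Group G] (A B : Subgroup G) : ℕ → Subgroup G
  | 0 => A
  | n + 1 => ⁅iterComm A B n, B⁆

namespace Subgroup

variable {G : Type*} [Group G]

theorem map_mk'_eq_bot_iff (K H : Subgroup G) [H.Normal] :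
    K.map (QuotientGroup.mk' H) = ⊥ ↔ K ≤ H := by
  rw [map_eq_bot_iff, QuotientGroup.ker_mk']

/-- The three subgroups lemma, relative to a normal subgroup. -/
theorem commutator_commutator_le_of_rotate {A B C H : Subgroup G} [H.Normal]
    (h₁ : ⁅⁅B, C⁆, A⁆ ≤ H) (h₂ : ⁅⁅C, A⁆, B⁆ ≤ H) : ⁅⁅A, B⁆, C⁆ ≤ H := by
  rw [← map_mk'_eq_bot_iff, map_commutator, map_commutator] at *
  exact commutator_commutator_eq_bot_of_rotate h₁ h₂

theorem commutator_commutator_top_le (A B : Subgroup G) [A.Normal] [B.Normal] :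
    ⁅⁅A, B⁆, (⊤ : Subgroup G)⁆ ≤ ⁅⁅A, (⊤ : Subgroup G)⁆, B⁆ ⊔ ⁅A, ⁅B, (⊤ : Subgroup G)⁆⁆ := by
  apply commutator_commutator_le_of_rotate
  · rw [commutator_comm]
    exact le_sup_right
  · rw [commutator_comm ⊤ A]
    exact le_sup_left

theorem commutator_top_le_iff_le_comap_center (K H : Subgroup G) [H.Normal] :
    ⁅K, (⊤ : Subgroup G)⁆ ≤ H ↔ K ≤ (center (G ⧸ H)).comap (QuotientGroup.mk' H) := by
  rw [← map_mk'_eq_bot_iff, map_commutator,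
    map_top_of_surjective _ (QuotientGroup.mk'_surjective H),
    commutator_top_right_eq_bot_iff_le_center, map_le_iff_le_comap]

theorem normal_iSup_of_normal {ι : Sort*} {K : ι → Subgroup G} (hK : ∀ i, (K i).Normal) :
    (⨆ i, K i).Normal := by
  refine ⟨fun x hx g ↦ ?_⟩
  have h : ⨆ i, K i ≤ (⨆ i, K i).comap (MulAut.conj g).toMonoidHom :=
    iSup_le fun i y hy ↦ le_iSup K i ((hK i).conj_mem y hy g)
  exact h hx

end Subgroup

theorem iterComm_normal {G : Type*} [Group G] (A B : Subgroup G) [A.Normal] [B.Normal] (n : ℕ) :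
    (iterComm A B n).Normal := by
  induction n with
  | zero => assumption
  | succ n ih => exact Subgroup.commutator_normal _ _

/-- For `M, N` normal subgroups of `G`,
`[[M,N],_n G] ≤ ∏_{ℓ=0}^{n} [[M,_{n-ℓ}G], [N,_ℓ G]]` (the product/join of the subgroups). -/
theorem iterComm_commutator_le (G : Type*) [Group G] (M N : Subgroup G)
    [M.Normal] [N.Normal] (n : ℕ) :
    iterComm ⁅M, N⁆ (⊤ : Subgroup G) n ≤
      ⨆ ℓ ∈ Finset.range (n + 1),
        ⁅iterComm M (⊤ : Subgroup G) (n - ℓ), iterComm N (⊤ : Subgroup G) ℓ⁆ := by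
  have hM := iterComm_normal M (⊤ : Subgroup G)
  have hN := iterComm_normal N (⊤ : Subgroup G)
  induction n with
  | zero => simp [iterComm]
  | succ n ih =>
    have : (⨆ ℓ ∈ Finset.range (n + 1 + 1),
        ⁅iterComm M (⊤ : Subgroup G) (n + 1 - ℓ), iterComm N (⊤ : Subgroup G) ℓ⁆).Normal :=
      Subgroup.normal_iSup_of_normal fun ℓ ↦ Subgroup.normal_iSup_of_normal fun _ ↦
        Subgroup.commutator_normal _ _
    refine (Subgroup.commutator_top_le_iff_le_comap_center _ _).2
      (ih.trans (iSup₂_le fun ℓ hℓ ↦ ?_))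
    rw [← Subgroup.commutator_top_le_iff_le_comap_center]
    rw [Finset.mem_range] at hℓ
    refine (Subgroup.commutator_commutator_top_le _ _).trans (sup_le ?_ ?_)
    · refine le_iSup₂_of_le ℓ (Finset.mem_range.2 (by lia)) ?_
      rw [show n + 1 - ℓ = n - ℓ + 1 by lia, iterComm]
    · refine le_iSup₂_of_le (ℓ + 1) (Finset.mem_range.2 (by lia)) ?_
      rw [Nat.add_sub_add_right, iterComm]
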